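/- Let Ω be a bounded domain in ℝ^n, n ≥ 2, containing the origin, let p > 1, and set D_0 := sup_{x∈Ω}|x|. Then for every k ∈ ℕ, every D ≥ D_0 and every w ∈ C_c^∞(Ω), one has ∫_Ω (|w|^p/|x|^n) Y_k(|x|/D) X_{k+1}^2(|x|/D) dx ≤ p^p ∫_Ω |x|^{p−n} |∇w|^p Y_k^{1−p}(|x|/D) X_{k+1}^{2−p}(|x|/D) dx. -/

import Mathlib

open MeasureTheory Real Set

noncomputable def X1 (t : ℝ) : ℝ := (1 - Real.log t)⁻¹

/-- Iterated logarithmic function: `XX 0 t = t`, `XX (k+1) t = X1 (XX k t)`;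
so `XX 1 = X_1`, `XX 2 = X_2`, ... of the paper. -/
noncomputable def XX : ℕ → ℝ → ℝ
  | 0, t => t
  | k + 1, t => X1 (XX k t)

/-- `YY k t = ∏_{i=1}^k X_i(t)`, with `YY 0 = 1`. -/
noncomputable def YY (k : ℕ) (t : ℝ) : ℝ := ∏ i ∈ Finset.Icc 1 k, XX i t

/-- `ZZ k t = ∑_{i=1}^k Y_i(t)`, with `ZZ 0 = 0`. -/
noncomputable def ZZ (k : ℕ) (t : ℝ) : ℝ := ∑ i ∈ Finset.Icc 1 k, YY i t

/-- The quantity `I_k[u; D]` of the paper. -/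
noncomputable def Ik (n : ℕ) (p D : ℝ) (Ω : Set (EuclideanSpace ℝ (Fin n))) (k : ℕ)
    (u : EuclideanSpace ℝ (Fin n) → ℝ) : ℝ :=
  (∫ x in Ω, ‖fderiv ℝ u x‖ ^ p)
    - |((n : ℝ) - p) / p| ^ p * ∫ x in Ω, |u x| ^ p / ‖x‖ ^ p
    - ((p - 1) / (2 * p)) * |((n : ℝ) - p) / p| ^ (p - 2) *
        ∫ x in Ω, (|u x| ^ p / ‖x‖ ^ p) * ∑ i ∈ Finset.Icc 1 k, (YY i (‖x‖ / D)) ^ 2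

lemma X1_mem_Ioc {t : ℝ} (ht : t ∈ Ioc (0 : ℝ) 1) : X1 t ∈ Ioc (0 : ℝ) 1 := by
  have h : Real.log t ≤ 0 := Real.log_nonpos ht.1.le ht.2
  exact ⟨inv_pos.2 (by linarith), inv_le_one_of_one_le₀ (by linarith)⟩

lemma le_X1 {t : ℝ} (ht : t ∈ Ioc (0 : ℝ) 1) : t ≤ X1 t := by
  have h : Real.log t ≤ 0 := Real.log_nonpos ht.1.le ht.2
  have h' := Real.one_sub_inv_le_log_of_pos ht.1
  exact (le_inv_comm₀ ht.1 (by linarith)).2 (by linarith)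

lemma XX_mem_Ioc (k : ℕ) {t : ℝ} (ht : t ∈ Ioc (0 : ℝ) 1) : XX k t ∈ Ioc (0 : ℝ) 1 := by
  induction k with
  | zero => exact ht
  | succ k ih => exact X1_mem_Ioc ih

lemma X1_le_XX_succ (k : ℕ) {t : ℝ} (ht : t ∈ Ioc (0 : ℝ) 1) : X1 t ≤ XX (k + 1) t := by
  induction k with
  | zero => exact le_rfl
  | succ k ih => exact ih.trans (le_X1 (XX_mem_Ioc (k + 1) ht))

lemma YY_succ (k : ℕ) (t : ℝ) : YY (k + 1) t = YY k t * XX (k + 1) t :=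
  Finset.prod_Icc_succ_top (by simp) _

lemma YY_pos (k : ℕ) {t : ℝ} (ht : t ∈ Ioc (0 : ℝ) 1) : 0 < YY k t :=
  Finset.prod_pos fun i _ => (XX_mem_Ioc i ht).1

lemma X1_pow_le_YY (k : ℕ) {t : ℝ} (ht : t ∈ Ioc (0 : ℝ) 1) : X1 t ^ k ≤ YY k t := by
  induction k with
  | zero => simp [YY]
  | succ k ih =>
    rw [pow_succ, YY_succ]
    exact mul_le_mul ih (X1_le_XX_succ k ht) (X1_mem_Ioc ht).1.le (YY_pos k ht).le

lemma hasDerivAt_XX (k : ℕ) {t : ℝ} (ht : t ∈ Ioc (0 : ℝ) 1) :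
    HasDerivAt (XX k) (YY k t * XX k t / t) t := by
  induction k with
  | zero =>
    have : YY 0 t * XX 0 t / t = 1 := by simp [YY, XX, ht.1.ne']
    rw [this]
    exact hasDerivAt_id t
  | succ k ih =>
    have hs := XX_mem_Ioc k ht
    have hlog : 1 - Real.log (XX k t) ≠ 0 := by
      have := Real.log_nonpos hs.1.le hs.2
      linarith
    convert! ((ih.log hs.1.ne').const_sub 1).inv hlog using 1
    rw [YY_succ]
    have hs0 := hs.1.ne'
    have ht0 := ht.1.ne'
    simp only [XX, X1]
    field_simp

lemma continuousOn_XX (k : ℕ) : ContinuousOn (XX k) (Ioc 0 1) :=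
  fun _ ht => (hasDerivAt_XX k ht).continuousAt.continuousWithinAt

lemma continuousOn_YY (k : ℕ) : ContinuousOn (YY k) (Ioc 0 1) :=
  continuousOn_finsetProd _ fun i _ => continuousOn_XX i

lemma measurable_XX (k : ℕ) : Measurable (XX k) := by
  induction k with
  | zero => exact measurable_id
  | succ k ih =>
    change Measurable fun t => (1 - Real.log (XX k t))⁻¹
    fun_prop

lemma measurable_YY (k : ℕ) : Measurable (YY k) :=
  Finset.measurable_prod _ fun i _ => measurable_XX i

/-- Young's inequality in the form `p a^(p-1) b ≤ b^p + (p-1) a^p`. -/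
lemma mul_rpow_sub_one_mul_le {p a b : ℝ} (hp : 1 < p) (ha : 0 ≤ a) (hb : 0 ≤ b) :
    p * (a ^ (p - 1) * b) ≤ b ^ p + (p - 1) * a ^ p := by
  have hpq := Real.HolderConjugate.conjExponent hp
  have h := Real.young_inequality_of_nonneg hb (rpow_nonneg ha (p - 1)) hpq
  rw [← Real.rpow_mul ha, Real.conjExponent, mul_div_cancel₀ _ (by linarith : p - 1 ≠ 0)] at h
  have hp0 : (0 : ℝ) < p := by linarith
  have h2 := mul_le_mul_of_nonneg_left h hp0.le
  have e : p * (b ^ p / p + a ^ p / (p / (p - 1))) = b ^ p + (p - 1) * a ^ p := by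
    field_simp
  rw [e] at h2
  linarith [mul_comm b (a ^ (p - 1))]

/-- The pointwise inequality underlying the one-dimensional Hardy inequality. -/
lemma hardy_pointwise {p a b r Y X : ℝ} (hp : 1 < p) (ha : 0 ≤ a) (hb : 0 ≤ b) (hr : 0 < r)
    (hY : 0 < Y) (hX : 0 < X) :
    p * (p * (a ^ (p - 1) * b)) * X ≤
      p ^ p * (r ^ (p - 1) * b ^ p * Y ^ (1 - p) * X ^ (2 - p)) +
        (p - 1) * (a ^ p / r * Y * X ^ 2) := by
  have hp0 : (0 : ℝ) < p := by linarith
  have h := mul_rpow_sub_one_mul_le hp ha (b := p * b * r / (Y * X)) (by positivity)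
  have h2 := mul_le_mul_of_nonneg_right h (by positivity : 0 ≤ Y * X ^ 2 / r)
  have e1 : p * (a ^ (p - 1) * (p * b * r / (Y * X))) * (Y * X ^ 2 / r)
      = p * (p * (a ^ (p - 1) * b)) * X := by
    field_simp
  have e2 : (p * b * r / (Y * X)) ^ p * (Y * X ^ 2 / r) =
      p ^ p * (r ^ (p - 1) * b ^ p * Y ^ (1 - p) * X ^ (2 - p)) := by
    rw [Real.div_rpow (by positivity) (by positivity), Real.mul_rpow (by positivity) hr.le,
      Real.mul_rpow hp0.le hb, Real.mul_rpow hY.le hX.le, Real.rpow_sub hr, Real.rpow_sub hY,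
      Real.rpow_sub hX, Real.rpow_one, Real.rpow_one, Real.rpow_two]
    field_simp
  rw [e1, add_mul, e2] at h2
  calc _ ≤ _ := h2
    _ = _ := by ring

/-- The weighted Hardy inequality on the segment `(ε, D)`. -/
lemma lintegral_Ioc_hardy {p D ε : ℝ} (hp : 1 < p) (hε : 0 < ε) (hεD : ε ≤ D) (k : ℕ)
    {f f' g : ℝ → ℝ} (hf : ∀ r, HasDerivAt f (f' r) r) (hfg : ∀ r, |f' r| ≤ g r)
    (hg : Continuous g) (hfD : f D = 0) :
    ∫⁻ r in Ioc ε D, ENNReal.ofReal (|f r| ^ p / r * YY k (r / D) * XX (k + 1) (r / D) ^ 2) ≤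
      ∫⁻ r in Ioc ε D, ENNReal.ofReal (p ^ p * (r ^ (p - 1) * g r ^ p * YY k (r / D) ^ (1 - p) *
        XX (k + 1) (r / D) ^ (2 - p))) := by
  have hD : 0 < D := hε.trans_le hεD
  have hp0 : (0 : ℝ) < p := by linarith
  have hmaps : MapsTo (fun r => r / D) (Icc ε D) (Ioc 0 1) := fun r hr =>
    ⟨div_pos (hε.trans_le hr.1) hD, (div_le_one hD).2 hr.2⟩
  have hdiv : ContinuousOn (fun r : ℝ => r / D) (Icc ε D) := by fun_prop
  have hXc : ContinuousOn (fun r => XX (k + 1) (r / D)) (Icc ε D) :=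
    (continuousOn_XX (k + 1)).comp hdiv hmaps
  have hYc : ContinuousOn (fun r => YY k (r / D)) (Icc ε D) :=
    (continuousOn_YY k).comp hdiv hmaps
  have hX0 : ∀ r ∈ Icc ε D, 0 < XX (k + 1) (r / D) := fun r hr =>
    (XX_mem_Ioc (k + 1) (hmaps hr)).1
  have hY0 : ∀ r ∈ Icc ε D, 0 < YY k (r / D) := fun r hr => YY_pos k (hmaps hr)
  have hr0 : ∀ r ∈ Icc ε D, 0 < r := fun r hr => hε.trans_le hr.1
  have hg0 : ∀ r, 0 ≤ g r := fun r => (abs_nonneg _).trans (hfg r)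
  have hfc : Continuous f := continuous_iff_continuousAt.2 fun r => (hf r).continuousAt
  have hfpc : Continuous fun r => |f r| ^ p := hfc.abs.rpow_const fun _ => Or.inr hp0.le
  have hgpc : Continuous fun r => g r ^ p := hg.rpow_const fun _ => Or.inr hp0.le
  set L : ℝ → ℝ := fun r => |f r| ^ p / r * YY k (r / D) * XX (k + 1) (r / D) ^ 2 with hL
  set R : ℝ → ℝ := fun r => p ^ p * (r ^ (p - 1) * g r ^ p * YY k (r / D) ^ (1 - p) *
        XX (k + 1) (r / D) ^ (2 - p)) with hR
  have hLc : ContinuousOn L (Icc ε D) :=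
    ((hfpc.continuousOn.div continuousOn_id fun r hr => (hr0 r hr).ne').mul hYc).mul (hXc.pow 2)
  have hRc : ContinuousOn R (Icc ε D) :=
    continuousOn_const.mul ((((continuousOn_id.rpow_const fun r hr => Or.inl (hr0 r hr).ne').mul
      hgpc.continuousOn).mul (hYc.rpow_const fun r hr => Or.inl (hY0 r hr).ne')).mul
      (hXc.rpow_const fun r hr => Or.inl (hX0 r hr).ne'))
  have hLi : IntegrableOn L (Icc ε D) := hLc.integrableOn_Icc
  have hRi : IntegrableOn R (Icc ε D) := hRc.integrableOn_Icc
  have hL0 : ∀ r ∈ Icc ε D, 0 ≤ L r := fun r hr => by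
    have := hr0 r hr
    have := hY0 r hr
    positivity
  have hR0 : ∀ r ∈ Icc ε D, 0 ≤ R r := fun r hr => by
    have := hr0 r hr
    have := hY0 r hr
    have := hX0 r hr
    have := hg0 r
    positivity
  have key : ∫ r in ε..D, (L r - R r) ≤
      p * (|f D| ^ p * XX (k + 1) (D / D)) - p * (|f ε| ^ p * XX (k + 1) (ε / D)) := by
    refine intervalIntegral.integral_le_sub_of_hasDeriv_right_of_le
      (g := fun r => p * (|f r| ^ p * XX (k + 1) (r / D)))
      (g' := fun r => p * ((p * |f r| ^ (p - 2) * f r * f' r) * XX (k + 1) (r / D) +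
        |f r| ^ p * (YY (k + 1) (r / D) * XX (k + 1) (r / D) / (r / D) * (1 / D)))) hεD
      (continuousOn_const.mul (hfpc.continuousOn.mul hXc)) (fun r hr => ?_) (hLi.sub hRi)
      fun r hr => ?_
    · have hr := Ioo_subset_Icc_self hr
      have h1 := (hasDerivAt_abs_rpow (f r) hp).comp r (hf r)
      have h2 := (hasDerivAt_XX (k + 1) (hmaps hr)).comp r ((hasDerivAt_id r).div_const D)
      exact ((h1.mul h2).const_mul p).hasDerivWithinAt
    · have hr := Ioo_subset_Icc_self hr
      have hr' := hr0 r hr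
      have hXr := hX0 r hr
      have hpt := hardy_pointwise hp (abs_nonneg (f r)) (hg0 r) hr' (hY0 r hr) hXr
      have hneg : -(p * (|f r| ^ (p - 1) * g r)) ≤ p * |f r| ^ (p - 2) * f r * f' r := by
        refine neg_le_of_abs_le ?_
        have : |p * |f r| ^ (p - 2) * f r * f' r| = p * (|f r| ^ (p - 2) * |f r| * |f' r|) := by
          rw [abs_mul, abs_mul, abs_mul, abs_of_pos hp0, abs_of_nonneg (a := |f r| ^ (p - 2))
            (by positivity)]
          ring
        rw [this]
        have h3 : |f r| ^ (p - 2) * |f r| = |f r| ^ (p - 1) := by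
          rcases (abs_nonneg (f r)).eq_or_lt with h | h
          · rw [← h, mul_zero, Real.zero_rpow (by linarith)]
          · rw [← Real.rpow_add_one h.ne']
            congr 1
            ring
        rw [h3]
        have := hfg r
        gcongr
      have h4 : |f r| ^ p * (YY (k + 1) (r / D) * XX (k + 1) (r / D) / (r / D) * (1 / D)) = L r := by
        rw [YY_succ]
        simp only [hL]
        field_simp
      rw [h4]
      have h5 := mul_le_mul_of_nonneg_left (mul_le_mul_of_nonneg_right hneg hXr.le) hp0.le
      simp only [hL, hR]
      nlinarith
  have hb : ∫ r in ε..D, (L r - R r) ≤ 0 := by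
    refine key.trans ?_
    rw [hfD, abs_zero, Real.zero_rpow hp0.ne', zero_mul, mul_zero, zero_sub, neg_nonpos]
    have := hX0 ε ⟨le_rfl, hεD⟩
    positivity
  have hLi' : IntegrableOn L (Ioc ε D) := hLi.mono_set Ioc_subset_Icc_self
  have hRi' : IntegrableOn R (Ioc ε D) := hRi.mono_set Ioc_subset_Icc_self
  rw [intervalIntegral.integral_of_le hεD, integral_sub hLi' hRi', sub_nonpos] at hb
  rw [← ofReal_integral_eq_lintegral_ofReal hLi', ← ofReal_integral_eq_lintegral_ofReal hRi']
  · exact ENNReal.ofReal_le_ofReal hb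
  · filter_upwards [ae_restrict_mem measurableSet_Ioc] with r hr
    exact hR0 r (Ioc_subset_Icc_self hr)
  · filter_upwards [ae_restrict_mem measurableSet_Ioc] with r hr
    exact hL0 r (Ioc_subset_Icc_self hr)

/-- The weighted Hardy inequality on the segment `(0, D)`. -/
lemma lintegral_Ioo_hardy {p D : ℝ} (hp : 1 < p) (hD : 0 < D) (k : ℕ)
    {f f' g : ℝ → ℝ} (hf : ∀ r, HasDerivAt f (f' r) r) (hfg : ∀ r, |f' r| ≤ g r)
    (hg : Continuous g) (hfD : f D = 0) :
    ∫⁻ r in Ioo 0 D, ENNReal.ofReal (|f r| ^ p / r * YY k (r / D) * XX (k + 1) (r / D) ^ 2) ≤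
      ∫⁻ r in Ioo 0 D, ENNReal.ofReal (p ^ p * (r ^ (p - 1) * g r ^ p * YY k (r / D) ^ (1 - p) *
        XX (k + 1) (r / D) ^ (2 - p))) := by
  have hU : Ioc 0 D = ⋃ m : ℕ, Ioc (D / (m + 1)) D := by
    ext r
    simp only [mem_iUnion, mem_Ioc, exists_and_right]
    refine and_congr_left fun _ => ⟨fun hr => ?_, fun ⟨m, hm⟩ => lt_trans (by positivity) hm⟩
    obtain ⟨m, hm⟩ := exists_nat_gt (D / r)
    refine ⟨m, (div_lt_comm₀ hr (by positivity)).1 (hm.trans (by linarith))⟩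
  have hmono : Monotone fun m : ℕ => Ioc (D / ((m : ℝ) + 1)) D := fun a b hab =>
    Ioc_subset_Ioc_left (by gcongr)
  rw [setLIntegral_congr Ioo_ae_eq_Ioc, setLIntegral_congr Ioo_ae_eq_Ioc]
  conv_lhs => rw [hU]
  rw [setLIntegral_iUnion_of_directed _ hmono.directed_le]
  refine iSup_le fun m => ?_
  have hm : 0 < D / ((m : ℝ) + 1) := by positivity
  refine (lintegral_Ioc_hardy hp hm
    (div_le_self hD.le (by linarith [m.cast_nonneg (α := ℝ)])) k hf hfg hg hfD).trans ?_
  exact lintegral_mono_set (Ioc_subset_Ioc_left hm.le)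

/-- Polar coordinates for the lower Lebesgue integral over a ball. -/
lemma lintegral_ball_eq_lintegral_sphere {E : Type*} [NormedAddCommGroup E] [NormedSpace ℝ E]
    [FiniteDimensional ℝ E] [Nontrivial E] [MeasurableSpace E] [BorelSpace E] (μ : Measure E)
    [μ.IsAddHaarMeasure] (D : ℝ) {f : E → ENNReal} (hf : Measurable f) :
    ∫⁻ x in Metric.ball 0 D, f x ∂μ = ∫⁻ θ : Metric.sphere (0 : E) 1, (∫⁻ r in Ioo 0 D,
      ENNReal.ofReal (r ^ (Module.finrank ℝ E - 1)) * f (r • (θ : E))) ∂μ.toSphere := by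
  set g : E → ENNReal := (Metric.ball 0 D).indicator f with hg
  have hgm : Measurable g := hf.indicator measurableSet_ball
  have hsm : Measurable fun q : Metric.sphere (0 : E) 1 × Ioi (0 : ℝ) => g ((q.2 : ℝ) • (q.1 : E)) :=
    hgm.comp (by fun_prop)
  rw [← lintegral_indicator measurableSet_ball, ← hg]
  calc ∫⁻ x, g x ∂μ = ∫⁻ x : ({(0)}ᶜ : Set E), g x ∂(μ.comap (↑)) := by
        rw [lintegral_subtype_comap (measurableSet_singleton _).compl, restrict_compl_singleton]
    _ = ∫⁻ q, g ((q.2 : ℝ) • (q.1 : E))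
          ∂(μ.toSphere.prod (.volumeIoiPow (Module.finrank ℝ E - 1))) := by
        rw [← μ.measurePreserving_homeomorphUnitSphereProd.lintegral_comp hsm]
        refine lintegral_congr fun x => ?_
        congr 1
        exact congrArg Subtype.val ((homeomorphUnitSphereProd E).symm_apply_apply x).symm
    _ = ∫⁻ θ : Metric.sphere (0 : E) 1, ∫⁻ r : Ioi (0 : ℝ), g ((r : ℝ) • (θ : E))
          ∂(Measure.volumeIoiPow (Module.finrank ℝ E - 1)) ∂μ.toSphere :=
        lintegral_prod _ hsm.aemeasurable
    _ = _ := by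
        refine lintegral_congr fun θ => ?_
        have hθ : ‖(θ : E)‖ = 1 := by simp
        have hθm : Measurable fun r : Ioi (0 : ℝ) => g ((r : ℝ) • (θ : E)) :=
          hsm.comp measurable_prodMk_left
        rw [Measure.volumeIoiPow, lintegral_withDensity_eq_lintegral_mul _ (by fun_prop) hθm]
        refine (lintegral_subtype_comap measurableSet_Ioi fun r : ℝ =>
          ENNReal.ofReal (r ^ (Module.finrank ℝ E - 1)) * g (r • (θ : E))).trans ?_
        rw [← lintegral_indicator measurableSet_Ioi, ← lintegral_indicator measurableSet_Ioo]
        refine lintegral_congr fun r => ?_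
        by_cases h0 : 0 < r
        · by_cases hr : r < D <;> simp [hg, h0, hr, norm_smul, hθ, abs_of_pos, indicator]
        · simp [h0]

lemma one_sub_log_le {a t : ℝ} (ha : 0 < a) (ht : t ∈ Ioc (0 : ℝ) 1) :
    1 - Real.log t ≤ (1 + 1 / a) * t ^ (-a) := by
  have h := Real.log_le_rpow_div (inv_pos.2 ht.1).le ha
  rw [Real.log_inv, Real.inv_rpow ht.1.le, ← Real.rpow_neg ht.1.le] at h
  have h1 : 1 ≤ t ^ (-a) := Real.one_le_rpow_of_pos_of_le_one_of_nonpos ht.1 ht.2 (by linarith)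
  have e : (1 + 1 / a) * t ^ (-a) = t ^ (-a) + t ^ (-a) / a := by ring
  linarith

lemma exists_weight_bound {p b : ℝ} (hp : 1 < p) (hb : 0 < b) (k : ℕ) :
    ∃ C, 0 ≤ C ∧ ∀ t ∈ Ioc (0 : ℝ) 1, YY k t ^ (1 - p) * XX (k + 1) t ^ (2 - p) ≤ C * t ^ (-b) := by
  set M : ℝ := k * (p - 1) + p with hM
  have hM0 : 0 < M := by
    have : 0 ≤ (k : ℝ) * (p - 1) := mul_nonneg k.cast_nonneg (by linarith)
    linarith
  have ha : 0 < b / M := by positivity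
  refine ⟨(1 + 1 / (b / M)) ^ M, by positivity, fun t ht => ?_⟩
  have hx := X1_mem_Ioc ht
  have hX := XX_mem_Ioc (k + 1) ht
  have h1 : YY k t ^ (1 - p) ≤ (X1 t) ^ (-(k * (p - 1))) := by
    refine (Real.rpow_le_rpow_of_nonpos (pow_pos hx.1 k) (X1_pow_le_YY k ht)
      (by linarith : 1 - p ≤ 0)).trans_eq ?_
    rw [← Real.rpow_natCast, ← Real.rpow_mul hx.1.le]
    congr 1
    ring
  have h2 : XX (k + 1) t ^ (2 - p) ≤ X1 t ^ (-p) :=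
    (Real.rpow_le_rpow_of_exponent_ge hX.1 hX.2 (by linarith)).trans
      (Real.rpow_le_rpow_of_nonpos hx.1 (X1_le_XX_succ k ht) (by linarith))
  have hlog : 0 ≤ 1 - Real.log t := by linarith [Real.log_nonpos ht.1.le ht.2]
  have ht0 := ht.1
  calc _ ≤ X1 t ^ (-(k * (p - 1))) * X1 t ^ (-p) :=
        mul_le_mul h1 h2 (Real.rpow_nonneg hX.1.le _) (Real.rpow_nonneg hx.1.le _)
    _ = (1 - Real.log t) ^ M := by
        rw [← Real.rpow_add hx.1, X1, Real.inv_rpow hlog, ← Real.rpow_neg hlog]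
        congr 1
        rw [hM]
        ring
    _ ≤ ((1 + 1 / (b / M)) * t ^ (-(b / M))) ^ M :=
        Real.rpow_le_rpow hlog (one_sub_log_le ha ht) hM0.le
    _ = _ := by
        rw [Real.mul_rpow (by positivity) (by positivity), ← Real.rpow_mul ht.1.le]
        congr 2
        field_simp

lemma integrableOn_gradient_term {n : ℕ} (hn : 2 ≤ n) {p D : ℝ} (hp : 1 < p) (hD : 0 < D) (k : ℕ)
    {g : EuclideanSpace ℝ (Fin n) → ℝ} (hg : Continuous g) (hg0 : ∀ x, 0 ≤ g x) :
    IntegrableOn (fun x => ‖x‖ ^ (p - n) * g x ^ p * (YY k (‖x‖ / D)) ^ (1 - p) *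
      (XX (k + 1) (‖x‖ / D)) ^ (2 - p)) (Metric.ball 0 D) := by
  have : Nonempty (Fin n) := ⟨⟨0, by omega⟩⟩
  obtain ⟨K, hK⟩ := (isCompact_closedBall (0 : EuclideanSpace ℝ (Fin n)) D).exists_bound_of_continuousOn
    hg.continuousOn
  obtain ⟨C, hC0, hC⟩ := exists_weight_bound hp (b := p / 2) (by linarith) k
  have hmain : IntegrableOn (fun x : EuclideanSpace ℝ (Fin n) => ‖x‖ ^ (p / 2 - n))
      (Metric.ball 0 D) := by
    rw [integrableOn_fun_norm_addHaar volume (f := fun r => r ^ (p / 2 - n))]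
    have hi : IntegrableOn (fun r : ℝ => r ^ (p / 2 - 1)) (Ioo 0 D) := by
      rw [intervalIntegral.integrableOn_Ioo_rpow_iff hD]
      linarith
    refine hi.congr_fun (fun r hr => ?_) measurableSet_Ioo
    simp only [finrank_euclideanSpace, Fintype.card_fin, smul_eq_mul]
    rw [← Real.rpow_natCast, ← Real.rpow_add hr.1, Nat.cast_sub (by omega)]
    congr 1
    push_cast
    ring
  have hXm := measurable_XX (k + 1)
  have hYm := measurable_YY k
  have hgm := hg.measurable
  refine Integrable.mono' (hmain.const_mul (K ^ p * C * D ^ (p / 2)))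
    (by fun_prop) ?_
  filter_upwards [ae_restrict_mem measurableSet_ball,
    ae_restrict_of_ae (Measure.ae_ne volume (0 : EuclideanSpace ℝ (Fin n)))] with x hx hx0
  have hr : 0 < ‖x‖ := norm_pos_iff.2 hx0
  have hxD : ‖x‖ < D := by simpa using hx
  have ht : ‖x‖ / D ∈ Ioc (0 : ℝ) 1 := ⟨by positivity, (div_le_one hD).2 hxD.le⟩
  have hY := YY_pos k ht
  have hX := (XX_mem_Ioc (k + 1) ht).1
  have hgx := hg0 x
  have hgK : g x ≤ K := (le_abs_self _).trans (hK x (by simpa using hxD.le))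
  rw [Real.norm_of_nonneg (by positivity), mul_assoc]
  calc _ ≤ ‖x‖ ^ (p - n) * K ^ p * (C * (‖x‖ / D) ^ (-(p / 2))) := by
        have := hC _ ht
        have hK0 : 0 ≤ K := hgx.trans hgK
        gcongr
    _ = _ := by
        rw [Real.div_rpow hr.le hD.le, Real.rpow_neg hD.le, div_inv_eq_mul]
        have e : ‖x‖ ^ (p - n) * ‖x‖ ^ (-(p / 2)) = ‖x‖ ^ (p / 2 - n) := by
          rw [← Real.rpow_add hr]
          congr 1
          ring
        rw [← e]
        ring

/-- The weighted Hardy inequality on the ball of radius `D`. -/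
lemma lintegral_ball_hardy {n : ℕ} (hn : 2 ≤ n) {p D : ℝ} (hp : 1 < p) (hD : 0 < D) (k : ℕ)
    {w : EuclideanSpace ℝ (Fin n) → ℝ} (hw : ContDiff ℝ 1 w) (hwD : ∀ x, ‖x‖ = D → w x = 0) :
    ∫⁻ x in Metric.ball 0 D, ENNReal.ofReal ((|w x| ^ p / ‖x‖ ^ (n : ℝ)) * YY k (‖x‖ / D) *
        (XX (k + 1) (‖x‖ / D)) ^ 2) ≤
      ∫⁻ x in Metric.ball 0 D, ENNReal.ofReal (p ^ p * (‖x‖ ^ (p - n) * ‖fderiv ℝ w x‖ ^ p *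
        (YY k (‖x‖ / D)) ^ (1 - p) * (XX (k + 1) (‖x‖ / D)) ^ (2 - p))) := by
  have : Nonempty (Fin n) := ⟨⟨0, by omega⟩⟩
  have hXm := measurable_XX (k + 1)
  have hYm := measurable_YY k
  have hdw : Continuous (fderiv ℝ w) := hw.continuous_fderiv one_ne_zero
  have hwm := hw.continuous.measurable
  have hdm : Measurable fun x => ‖fderiv ℝ w x‖ := hdw.norm.measurable
  rw [lintegral_ball_eq_lintegral_sphere volume D (by fun_prop),
    lintegral_ball_eq_lintegral_sphere volume D (by fun_prop)]
  refine lintegral_mono fun θ => ?_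
  have hθ : ‖(θ : EuclideanSpace ℝ (Fin n))‖ = 1 := by simp
  have hnorm : ∀ r : ℝ, 0 < r → ‖r • (θ : EuclideanSpace ℝ (Fin n))‖ = r := fun r hr => by
    rw [norm_smul, hθ, mul_one, Real.norm_of_nonneg hr.le]
  have hpow : ∀ r : ℝ, 0 < r → r ^ (n - 1) = r ^ (n : ℝ) / r := fun r hr => by
    rw [Real.rpow_natCast, eq_div_iff hr.ne', ← pow_succ, Nat.sub_add_cancel (by omega)]
  have h := lintegral_Ioo_hardy hp hD k (f := fun r => w (r • (θ : EuclideanSpace ℝ (Fin n))))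
    (f' := fun r => fderiv ℝ w (r • (θ : EuclideanSpace ℝ (Fin n))) θ)
    (g := fun r => ‖fderiv ℝ w (r • (θ : EuclideanSpace ℝ (Fin n)))‖) (fun r => ?_) (fun r => ?_)
    (by fun_prop) (hwD _ (hnorm D hD))
  · convert h using 1
    all_goals
      refine setLIntegral_congr_fun measurableSet_Ioo fun r hr => ?_
      have hr0 : 0 < r := hr.1
      have hrn : r ^ (n : ℝ) ≠ 0 := (Real.rpow_pos_of_pos hr0 _).ne'
      simp only [finrank_euclideanSpace, Fintype.card_fin]
      rw [← ENNReal.ofReal_mul (by positivity), hnorm r hr0, hpow r hr0]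
    · congr 1
      field_simp
    · rw [Real.rpow_sub hr0, Real.rpow_sub hr0, Real.rpow_one]
      congr 1
      field_simp
  · have h1 := (hw.differentiable one_ne_zero (r • (θ : EuclideanSpace ℝ (Fin n)))).hasFDerivAt
    have h2 := (hasDerivAt_id r).smul_const (θ : EuclideanSpace ℝ (Fin n))
    rw [one_smul] at h2
    exact h1.comp_hasDerivAt r h2
  · simpa [hθ] using (fderiv ℝ w (r • (θ : EuclideanSpace ℝ (Fin n)))).le_opNorm θ

/-- Elementary weighted Hardy inequality (Lemma 2.9 of the paper). -/
theorem weighted_hardy_log (n : ℕ) (hn : 2 ≤ n) (p : ℝ) (hp : 1 < p)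
    (Ω : Set (EuclideanSpace ℝ (Fin n))) (hΩo : IsOpen Ω) (hΩc : IsConnected Ω)
    (hΩb : Bornology.IsBounded Ω) (h0 : (0 : EuclideanSpace ℝ (Fin n)) ∈ Ω)
    (D₀ : ℝ) (hD₀ : D₀ = sSup (norm '' Ω)) :
    ∀ (k : ℕ), 1 ≤ k → ∀ D : ℝ, D₀ ≤ D →
      ∀ w : EuclideanSpace ℝ (Fin n) → ℝ,
        ContDiff ℝ (⊤ : ℕ∞) w → HasCompactSupport w → tsupport w ⊆ Ω →
        (∫ x in Ω, (|w x| ^ p / ‖x‖ ^ (n : ℝ)) * YY k (‖x‖ / D) *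
            (XX (k + 1) (‖x‖ / D)) ^ 2) ≤
          p ^ p * ∫ x in Ω, ‖x‖ ^ (p - n) * ‖fderiv ℝ w x‖ ^ p *
            (YY k (‖x‖ / D)) ^ (1 - p) * (XX (k + 1) (‖x‖ / D)) ^ (2 - p) := by
  intro k _ D hDD w hw _ hwΩ
  have hΩD : Ω ⊆ Metric.ball 0 D := by
    have : Nonempty (Fin n) := ⟨⟨0, by omega⟩⟩
    rw [← interior_closedBall' (0 : EuclideanSpace ℝ (Fin n)) D]
    refine interior_maximal (fun x hx => ?_) hΩo
    rw [mem_closedBall_zero_iff]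
    obtain ⟨C, hC⟩ := hΩb.exists_norm_le
    refine le_trans (le_csSup ⟨C, ?_⟩ (mem_image_of_mem _ hx)) (hD₀ ▸ hDD)
    rintro _ ⟨y, hy, rfl⟩
    exact hC y hy
  have hD : 0 < D := by simpa using hΩD h0
  have hw0 : ∀ x, x ∉ Ω → w x = 0 := fun x hx =>
    image_eq_zero_of_notMem_tsupport fun h => hx (hwΩ h)
  have hdw0 : ∀ x, x ∉ Ω → fderiv ℝ w x = 0 := fun x hx =>
    image_eq_zero_of_notMem_tsupport fun h => hx (hwΩ (tsupport_fderiv_subset ℝ h))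
  have hw1 : ContDiff ℝ 1 w := hw.of_le (by exact_mod_cast le_top)
  have hdw : Continuous (fderiv ℝ w) := hw1.continuous_fderiv one_ne_zero
  have hp0 : p ≠ 0 := by linarith
  rw [← setIntegral_eq_of_subset_of_forall_sdiff_eq_zero measurableSet_ball hΩD
      (fun x hx => by simp [hw0 x hx.2, Real.zero_rpow hp0]),
    ← setIntegral_eq_of_subset_of_forall_sdiff_eq_zero measurableSet_ball hΩD
      (fun x hx => by simp [hdw0 x hx.2, Real.zero_rpow hp0]), ← integral_const_mul]
  have hR := (integrableOn_gradient_term hn hp hD k hdw.norm fun x => norm_nonneg _).const_mul (p ^ p)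
  have hmem : ∀ᵐ x ∂(volume.restrict (Metric.ball (0 : EuclideanSpace ℝ (Fin n)) D)),
      ‖x‖ / D ∈ Ioc (0 : ℝ) 1 := by
    have : Nonempty (Fin n) := ⟨⟨0, by omega⟩⟩
    filter_upwards [ae_restrict_mem measurableSet_ball,
      ae_restrict_of_ae (Measure.ae_ne volume (0 : EuclideanSpace ℝ (Fin n)))] with x hx hx0
    have hxD : ‖x‖ < D := by simpa using hx
    exact ⟨div_pos (norm_pos_iff.2 hx0) hD, (div_le_one hD).2 hxD.le⟩
  have hXm := measurable_XX (k + 1)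
  have hYm := measurable_YY k
  have hwm := hw.continuous.measurable
  have hRpos : 0 ≤ᵐ[volume.restrict (Metric.ball (0 : EuclideanSpace ℝ (Fin n)) D)]
      fun x => p ^ p * (‖x‖ ^ (p - n) * ‖fderiv ℝ w x‖ ^ p *
        (YY k (‖x‖ / D)) ^ (1 - p) * (XX (k + 1) (‖x‖ / D)) ^ (2 - p)) := by
    filter_upwards [hmem] with x hx
    have := YY_pos k hx
    have := (XX_mem_Ioc (k + 1) hx).1
    positivity
  rw [integral_eq_lintegral_of_nonneg_ae _ (Measurable.aestronglyMeasurable (by fun_prop)),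
    integral_eq_lintegral_of_nonneg_ae hRpos hR.aestronglyMeasurable]
  · refine ENNReal.toReal_mono ?_ (lintegral_ball_hardy hn hp hD k hw1 fun x hx => hw0 x fun h => ?_)
    · exact ((hasFiniteIntegral_iff_ofReal hRpos).1 hR.hasFiniteIntegral).ne
    · exact (by simpa using hΩD h : ‖x‖ < D).ne hx
  · filter_upwards [hmem] with x hx
    have := YY_pos k hx
    positivity
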